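/- For every integer r ≥ 2 and every finitely generated subgroup H of the free group F_r, the limit lim_{n→∞} γ_H(n)^{1/n} exists (as a real number). -/

import Mathlib

open Filter Topology

/-- The growth function of a subgroup `H` of the free group `F_r`:
`γ_H(n)` counts the elements of `H` whose word length (length of the reduced
word with respect to the free generating set) is at most `n`. -/
noncomputable def subgroupGrowth {r : ℕ} (H : Subgroup (FreeGroup (Fin r))) (n : ℕ) : ℕ :=
  Nat.card {h : FreeGroup (Fin r) // h ∈ H ∧ (FreeGroup.toWord h).length ≤ n}

theorem List.IsPrefix.of_append {α : Type*} {p l₁ l₂ : List α} (h : p <+: l₁ ++ l₂) :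
    p <+: l₁ ∨ ∃ s, p = l₁ ++ s ∧ s <+: l₂ := by
  rcases List.prefix_or_prefix_of_prefix h (List.prefix_append l₁ l₂) with h1 | ⟨s, rfl⟩
  · exact .inl h1
  · exact .inr ⟨s, rfl, (List.prefix_append_right_inj l₁).mp h⟩

/-- A prefix of a reduction of `L` represents the same element as some prefix of `L`. -/
theorem FreeGroup.Red.exists_prefix_mk_eq {α : Type*} {L L' : List (α × Bool)}
    (h : FreeGroup.Red L L') {p : List (α × Bool)} (hp : p <+: L') :
    ∃ q, q <+: L ∧ FreeGroup.mk q = FreeGroup.mk p := by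
  induction h generalizing p with
  | refl => exact ⟨p, hp, rfl⟩
  | tail _ hstep ih =>
    obtain @⟨L₁, L₂, x, b⟩ := hstep
    rcases hp.of_append with h1 | ⟨s, rfl, hs⟩
    · exact ih (h1.trans (List.prefix_append _ _))
    · obtain ⟨q, hq, hqe⟩ := ih (p := L₁ ++ (x, b) :: (x, !b) :: s) (by simpa using hs)
      exact ⟨q, hq, hqe.trans (Quot.sound FreeGroup.Red.Step.not)⟩

/-- Finitely generated subgroups of free groups are quasiconvex. -/
theorem Subgroup.FG.exists_quasiconvex {α : Type*} [DecidableEq α] {H : Subgroup (FreeGroup α)}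
    (hH : H.FG) :
    ∃ D : ℕ, ∀ h ∈ H, ∀ p, p <+: h.toWord → ∃ t, t.norm ≤ D ∧ FreeGroup.mk p * t ∈ H := by
  obtain ⟨S, rfl⟩ := hH
  refine ⟨S.sup FreeGroup.norm, fun h hh p hp => ?_⟩
  suffices key : ∃ L, FreeGroup.mk L = h ∧ ∀ q, q <+: L →
      ∃ t : FreeGroup α, t.norm ≤ S.sup FreeGroup.norm ∧
        FreeGroup.mk q * t ∈ Subgroup.closure (S : Set (FreeGroup α)) by
    obtain ⟨L, rfl, hL⟩ := key
    rw [FreeGroup.toWord_mk] at hp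
    obtain ⟨q, hq, hqe⟩ := FreeGroup.reduce.red.exists_prefix_mk_eq hp
    exact hqe ▸ hL q hq
  clear hp p
  induction hh using Subgroup.closure_induction with
  | mem x hx =>
    refine ⟨x.toWord, FreeGroup.mk_toWord, fun q hq => ⟨(FreeGroup.mk q)⁻¹, ?_, ?_⟩⟩
    swap
    · rw [mul_inv_cancel]
      exact one_mem _
    rw [FreeGroup.norm_inv_eq]
    exact FreeGroup.norm_mk_le.trans (hq.length_le.trans (Finset.le_sup (f := FreeGroup.norm) hx))
  | one =>
    refine ⟨[], rfl, fun q hq => ⟨1, by simp, ?_⟩⟩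
    rw [List.prefix_nil.mp hq, mul_one]
    exact one_mem _
  | mul x y hx _ ihx ihy =>
    obtain ⟨L₁, rfl, h₁⟩ := ihx
    obtain ⟨L₂, rfl, h₂⟩ := ihy
    refine ⟨L₁ ++ L₂, FreeGroup.mul_mk.symm, fun q hq => ?_⟩
    rcases hq.of_append with h | ⟨s, rfl, hs⟩
    · exact h₁ q h
    · obtain ⟨t, ht, hmem⟩ := h₂ s hs
      refine ⟨t, ht, ?_⟩
      rw [← FreeGroup.mul_mk, mul_assoc]
      exact mul_mem hx hmem
  | inv x hx ih =>
    obtain ⟨L, rfl, hL⟩ := ih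
    refine ⟨FreeGroup.invRev L, FreeGroup.inv_mk.symm, fun q ⟨s, hs⟩ => ?_⟩
    have hLe : L = FreeGroup.invRev s ++ FreeGroup.invRev q := by
      rw [← FreeGroup.invRev_append, hs, FreeGroup.invRev_invRev]
    obtain ⟨t, ht, hmem⟩ := hL (FreeGroup.invRev s) ⟨_, hLe.symm⟩
    refine ⟨t, ht, ?_⟩
    have hq : FreeGroup.mk q = (FreeGroup.mk L)⁻¹ * FreeGroup.mk (FreeGroup.invRev s) := by
      rw [FreeGroup.inv_mk, ← hs, ← FreeGroup.mul_mk, ← FreeGroup.inv_mk]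
      group
    rw [hq, mul_assoc]
    exact mul_mem (inv_mem hx) hmem

instance finite_subgroup_ball {r : ℕ} (H : Subgroup (FreeGroup (Fin r))) (n : ℕ) :
    Finite {h : FreeGroup (Fin r) // h ∈ H ∧ (FreeGroup.toWord h).length ≤ n} := by
  have : Finite {l : List (Fin r × Bool) // l.length ≤ n} := List.finite_length_le _ n
  refine Finite.of_injective
    (fun h => (⟨h.1.toWord, h.2.2⟩ : {l : List (Fin r × Bool) // l.length ≤ n})) ?_
  intro a b hab
  exact Subtype.ext (FreeGroup.toWord_injective (congrArg Subtype.val hab))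

theorem subgroupGrowth_pos {r : ℕ} (H : Subgroup (FreeGroup (Fin r))) (n : ℕ) :
    0 < subgroupGrowth H n :=
  have : Nonempty {h : FreeGroup (Fin r) // h ∈ H ∧ (FreeGroup.toWord h).length ≤ n} :=
    ⟨⟨1, one_mem H, by simp⟩⟩
  Nat.card_pos

theorem Subgroup.FG.exists_subgroupGrowth_add_le {r : ℕ} {H : Subgroup (FreeGroup (Fin r))}
    (hH : H.FG) :
    ∃ D, ∀ m n, subgroupGrowth H (m + n) ≤ subgroupGrowth H (m + D) * subgroupGrowth H (n + D) := by
  obtain ⟨D, hD⟩ := hH.exists_quasiconvex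
  refine ⟨D, fun m n => ?_⟩
  have key : ∀ h : {h : FreeGroup (Fin r) // h ∈ H ∧ (FreeGroup.toWord h).length ≤ m + n},
      ∃ p : {h : FreeGroup (Fin r) // h ∈ H ∧ (FreeGroup.toWord h).length ≤ m + D} ×
        {h : FreeGroup (Fin r) // h ∈ H ∧ (FreeGroup.toWord h).length ≤ n + D},
        p.1.1 * p.2.1 = h.1 := by
    rintro ⟨h, hh, hlen⟩
    obtain ⟨t, ht, hmem⟩ := hD h hh _ (List.take_prefix m h.toWord)
    have hsplit : FreeGroup.mk (h.toWord.take m) * FreeGroup.mk (h.toWord.drop m) = h := by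
      rw [FreeGroup.mul_mk, List.take_append_drop, FreeGroup.mk_toWord]
    refine ⟨⟨⟨_, hmem, ?_⟩, ⟨t⁻¹ * FreeGroup.mk (h.toWord.drop m), ?_, ?_⟩⟩, ?_⟩
    · refine (FreeGroup.norm_mul_le _ _).trans (add_le_add (FreeGroup.norm_mk_le.trans ?_) ht)
      simp
    · have := mul_mem (inv_mem hmem) hh
      convert this using 1
      nth_rewrite 3 [← hsplit]
      group
    · rw [add_comm n D]
      refine (FreeGroup.norm_mul_le _ _).trans
        (add_le_add (FreeGroup.norm_inv_eq.trans_le ht) (FreeGroup.norm_mk_le.trans ?_))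
      rw [List.length_drop]
      omega
    · simpa [mul_assoc] using hsplit
  choose f hf using key
  unfold subgroupGrowth
  rw [← Nat.card_prod]
  refine Nat.card_le_card_of_injective f fun a b hab => Subtype.ext ?_
  rw [← hf a, ← hf b, hab]

/-- Fekete's lemma for positive sequences that are submultiplicative up to a shift. -/
theorem exists_tendsto_rpow_of_add_le_mul {f : ℕ → ℝ} (h1 : ∀ n, 1 ≤ f n) {D : ℕ}
    (hf : ∀ m n, f (m + n) ≤ f (m + D) * f (n + D)) :
    ∃ L : ℝ, Tendsto (fun n : ℕ => f n ^ (1 / (n : ℝ))) atTop (𝓝 L) := by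
  have hpos : ∀ n, 0 < f n := fun n => one_pos.trans_le (h1 n)
  have hsub : Subadditive fun n => Real.log (f (n + 2 * D)) := by
    intro m n
    rw [← Real.log_mul (hpos _).ne' (hpos _).ne']
    refine Real.log_le_log (hpos _) ?_
    convert hf (m + D) (n + D) using 2 <;> ring_nf
  have hlim := hsub.tendsto_lim ⟨0, by
    rintro _ ⟨n, rfl⟩
    exact div_nonneg (Real.log_nonneg (h1 _)) n.cast_nonneg⟩
  refine ⟨Real.exp hsub.lim, ?_⟩
  rw [← tendsto_add_atTop_iff_nat (2 * D)]
  have hratio : Tendsto (fun n : ℕ => (n : ℝ) / (n + (2 * D : ℕ))) atTop (𝓝 1) :=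
    tendsto_natCast_div_add_atTop _
  have hmul := (Real.continuous_exp.tendsto _).comp (hlim.mul hratio)
  rw [mul_one] at hmul
  refine hmul.congr' ?_
  filter_upwards [eventually_gt_atTop 0] with n hn
  have hn' : (n : ℝ) ≠ 0 := by positivity
  simp only [Function.comp_apply]
  rw [Real.rpow_def_of_pos (hpos _), div_mul_div_cancel₀ hn', mul_one_div, Nat.cast_add]

/-- For every finitely generated subgroup `H` of the free group `F_r` (`r ≥ 2`),
the growth rate `lim_{n→∞} γ_H(n)^(1/n)` exists. -/
theorem stmt_9 (r : ℕ) (hr : 2 ≤ r) (H : Subgroup (FreeGroup (Fin r))) (hH : H.FG) :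
    ∃ L : ℝ, Tendsto (fun n : ℕ => (subgroupGrowth H n : ℝ) ^ (1 / (n : ℝ))) atTop (𝓝 L) := by
  obtain ⟨D, hD⟩ := hH.exists_subgroupGrowth_add_le
  exact exists_tendsto_rpow_of_add_le_mul
    (fun n => by exact_mod_cast subgroupGrowth_pos H n) (fun m n => by exact_mod_cast hD m n)
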